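/- Let ⟨−,−⟩: H ⊗ K → k be a dual pairing of Hopf algebras over a field k, C a k-coalgebra, A a unital k-algebra, and (−,−): A ⊗ C → k a non-degenerate dual pairing. Let C be a left partial K-comodule coalgebra with coaction λ(c) = c⁽⁻¹⁾ ⊗ c⁽⁰⁾ satisfying also the symmetric axiom (PLHCC3'). If ·: H ⊗ A → A is a linear map satisfying (h·a, c) = ⟨h, c⁽⁻¹⁾⟩(a, c⁽⁰⁾) for all h ∈ H, a ∈ A, c ∈ C, then · is a symmetric left partial action of H on A, i.e. it satisfies (PLA1), (PLA2), (PLA3) and (PLA3'). -/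

import Mathlib

open TensorProduct

/-- `sw2 k f g` is the Sweedler-style map `h ↦ ∑ f(h₍₁₎) * g(h₍₂₎)`. -/
noncomputable def sw2 (k : Type*) [Field k] {H A : Type*}
    [AddCommGroup H] [Module k H] [Coalgebra k H]
    [Ring A] [Algebra k A] (f g : H →ₗ[k] A) : H →ₗ[k] A :=
  TensorProduct.lift ((LinearMap.mul k A).compl₁₂ f g) ∘ₗ Coalgebra.comul
/-- A symmetric left partial action of a Hopf algebra `H` on a unital algebra `A`:
(PLA1) `1·a = a`; (PLA2) `h·(ab) = ∑ (h₍₁₎·a)(h₍₂₎·b)`;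
(PLA3) `h·(g·a) = ∑ (h₍₁₎·1)(h₍₂₎g·a)`; (PLA3') `h·(g·a) = ∑ (h₍₁₎g·a)(h₍₂₎·1)`. -/
structure IsSymmPartialAction (k : Type*) [Field k] {H A : Type*} [Ring H] [HopfAlgebra k H]
    [Ring A] [Algebra k A] (act : H →ₗ[k] A →ₗ[k] A) : Prop where
  pla1 : ∀ a : A, act 1 a = a
  pla2 : ∀ (h : H) (a b : A), act h (a * b) = sw2 k (act.flip a) (act.flip b) h
  pla3 : ∀ (h g : H) (a : A),
    act h (act g a) = sw2 k (act.flip 1) (act.flip a ∘ₗ LinearMap.mulRight k g) h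
  pla3' : ∀ (h g : H) (a : A),
    act h (act g a) = sw2 k (act.flip a ∘ₗ LinearMap.mulRight k g) (act.flip 1) h
/-- A dual pairing of Hopf algebras `⟨-,-⟩ : H ⊗ K → k`:
`⟨hh',x⟩ = ∑ ⟨h,x₍₁₎⟩⟨h',x₍₂₎⟩`, `⟨1,x⟩ = ε(x)`, `⟨h,xy⟩ = ∑ ⟨h₍₁₎,x⟩⟨h₍₂₎,y⟩`, `⟨h,1⟩ = ε(h)`. -/
structure IsHopfPairing (k : Type*) [Field k] {H K : Type*} [Ring H] [HopfAlgebra k H]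
    [Ring K] [HopfAlgebra k K] (p : H →ₗ[k] K →ₗ[k] k) : Prop where
  mul_left : ∀ (h h' : H) (x : K), p (h * h') x = sw2 k (p h) (p h') x
  one_left : ∀ x : K, p 1 x = Coalgebra.counit x
  mul_right : ∀ (h : H) (x y : K), p h (x * y) = sw2 k (p.flip x) (p.flip y) h
  one_right : ∀ h : H, p h 1 = Coalgebra.counit h
/-- A dual pairing `(-,-) : A ⊗ C → k` between a unital algebra `A` and a coalgebra `C`:
`(ab,c) = ∑ (a,c₍₁₎)(b,c₍₂₎)` and `(1,c) = ε(c)`. -/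
structure IsAlgCoalgPairing (k : Type*) [Field k] {A C : Type*} [Ring A] [Algebra k A]
    [AddCommGroup C] [Module k C] [Coalgebra k C] (q : A →ₗ[k] C →ₗ[k] k) : Prop where
  pair_mul : ∀ (a b : A) (c : C), q (a * b) c =
    (TensorProduct.lid k k) (TensorProduct.map (q a) (q b) (Coalgebra.comul (R := k) c))
  pair_one : ∀ c : C, q 1 c = Coalgebra.counit c
/-- The map `H ⊗ C → H`, `x ⊗ c ↦ ε(c)x`. -/
noncomputable def psiHC (k : Type*) [Field k] {H C : Type*}
    [AddCommGroup H] [Module k H]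
    [AddCommGroup C] [Module k C] [Coalgebra k C] : H ⊗[k] C →ₗ[k] H :=
  (TensorProduct.rid k H).toLinearMap ∘ₗ TensorProduct.map LinearMap.id Coalgebra.counit

/-- The map `H ⊗ (H ⊗ M) → H ⊗ M`, `x ⊗ (y ⊗ m) ↦ xy ⊗ m`. -/
noncomputable def mulFirst (k : Type*) [Field k] {H M : Type*} [Ring H] [Algebra k H]
    [AddCommGroup M] [Module k M] : H ⊗[k] (H ⊗[k] M) →ₗ[k] H ⊗[k] M :=
  TensorProduct.map (LinearMap.mul' k H) LinearMap.id ∘ₗ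
    (TensorProduct.assoc k H H M).symm.toLinearMap

/-- A left partial `H`-comodule coalgebra over a bialgebra `H`:
(PLHCC1) `(id ⊗ Δ)λ(c) = ∑ c₍₁₎⁽⁻¹⁾c₍₂₎⁽⁻¹⁾ ⊗ c₍₁₎⁽⁰⁾ ⊗ c₍₂₎⁽⁰⁾`;
(PLHCC2) `(ε ⊗ id)λ(c) = c`;
(PLHCC3) `(id ⊗ λ)λ(c) = ∑ c₍₁₎⁽⁻¹⁾ε(c₍₁₎⁽⁰⁾)(c₍₂₎⁽⁻¹⁾)₍₁₎ ⊗ (c₍₂₎⁽⁻¹⁾)₍₂₎ ⊗ c₍₂₎⁽⁰⁾`. -/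
structure IsPartialComoduleCoalgebra (k : Type*) [Field k] {H C : Type*} [Ring H] [Bialgebra k H]
    [AddCommGroup C] [Module k C] [Coalgebra k C] (lam : C →ₗ[k] H ⊗[k] C) : Prop where
  plhcc1 : ∀ c : C,
    TensorProduct.map LinearMap.id (Coalgebra.comul (R := k)) (lam c) =
    TensorProduct.map (LinearMap.mul' k H) LinearMap.id
      ((TensorProduct.tensorTensorTensorComm k H C H C)
        (TensorProduct.map lam lam (Coalgebra.comul (R := k) c)))
  plhcc2 : ∀ c : C,
    (TensorProduct.lid k C) (TensorProduct.map Coalgebra.counit LinearMap.id (lam c)) = c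
  plhcc3 : ∀ c : C,
    TensorProduct.map LinearMap.id lam (lam c) =
    mulFirst k (TensorProduct.map (psiHC k)
      ((TensorProduct.assoc k H H C).toLinearMap ∘ₗ
        TensorProduct.map (Coalgebra.comul (R := k)) LinearMap.id)
      (TensorProduct.map lam lam (Coalgebra.comul (R := k) c)))

/-- The symmetric axiom (PLHCC3') for a left partial `H`-comodule coalgebra:
`(id ⊗ λ)λ(c) = ∑ (c₍₁₎⁽⁻¹⁾)₍₁₎c₍₂₎⁽⁻¹⁾ε(c₍₂₎⁽⁰⁾) ⊗ (c₍₁₎⁽⁻¹⁾)₍₂₎ ⊗ c₍₁₎⁽⁰⁾`. -/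
def PLHCC3' (k : Type*) [Field k] {H C : Type*} [Ring H] [Bialgebra k H]
    [AddCommGroup C] [Module k C] [Coalgebra k C] (lam : C →ₗ[k] H ⊗[k] C) : Prop :=
  ∀ c : C,
    TensorProduct.map LinearMap.id lam (lam c) =
    mulFirst k ((TensorProduct.map LinearMap.id
        (TensorProduct.comm k (H ⊗[k] C) H).toLinearMap)
      ((TensorProduct.assoc k H (H ⊗[k] C) H)
        (TensorProduct.map
          ((TensorProduct.assoc k H H C).toLinearMap ∘ₗ
            TensorProduct.map (Coalgebra.comul (R := k)) LinearMap.id)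
          (psiHC k)
          (TensorProduct.map lam lam (Coalgebra.comul (R := k) c)))))

theorem sw2_apply_repr {k H A : Type*} [Field k] [AddCommGroup H] [Module k H] [Coalgebra k H]
    [Ring A] [Algebra k A] (f g : H →ₗ[k] A) {h : H} {ι : Type*} (R : Coalgebra.Repr k h ι) :
    sw2 k f g h = ∑ i ∈ R.index, f (R.left i) * g (R.right i) := by
  rw [sw2, LinearMap.comp_apply, ← R.eq, map_sum]
  simp

/-- The functional `x ⊗ y ↦ f x * g y` on a tensor product. -/
noncomputable def tensorFunctional {k M N : Type*} [Field k] [AddCommGroup M] [Module k M]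
    [AddCommGroup N] [Module k N] (f : M →ₗ[k] k) (g : N →ₗ[k] k) : M ⊗[k] N →ₗ[k] k :=
  (TensorProduct.lid k k).toLinearMap ∘ₗ TensorProduct.map f g

section

variable {k M N P Q : Type*} [Field k] [AddCommGroup M] [Module k M] [AddCommGroup N] [Module k N]
  [AddCommGroup P] [Module k P] [AddCommGroup Q] [Module k Q]

@[simp]
theorem tensorFunctional_tmul (f : M →ₗ[k] k) (g : N →ₗ[k] k) (x : M) (y : N) :
    tensorFunctional f g (x ⊗ₜ y) = f x * g y := by
  simp [tensorFunctional]

theorem tensorFunctional_map (f : M →ₗ[k] k) (g : N →ₗ[k] k) (u : P →ₗ[k] M) (v : Q →ₗ[k] N)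
    (t : P ⊗[k] Q) :
    tensorFunctional f g (TensorProduct.map u v t) = tensorFunctional (f ∘ₗ u) (g ∘ₗ v) t := by
  simp [tensorFunctional, TensorProduct.map_comp]

end

section

variable {k H K C : Type*} [Field k] [Ring H] [HopfAlgebra k H] [Ring K] [HopfAlgebra k K]
  [AddCommGroup C] [Module k C] {p : H →ₗ[k] K →ₗ[k] k}

theorem IsHopfPairing.tensorFunctional_mul' (hp : IsHopfPairing k p) {h : H} {ι : Type*}
    (R : Coalgebra.Repr k h ι) (f g : C →ₗ[k] k) (t : (K ⊗[k] C) ⊗[k] (K ⊗[k] C)) :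
    tensorFunctional (p h) (tensorFunctional f g) (TensorProduct.map (LinearMap.mul' k K)
      LinearMap.id (TensorProduct.tensorTensorTensorComm k K C K C t)) =
    ∑ i ∈ R.index, tensorFunctional (tensorFunctional (p (R.left i)) f)
      (tensorFunctional (p (R.right i)) g) t := by
  rw [← LinearMap.sum_apply]
  refine LinearMap.congr_fun (f := tensorFunctional (p h) (tensorFunctional f g) ∘ₗ
    TensorProduct.map (LinearMap.mul' k K) LinearMap.id ∘ₗ
    (TensorProduct.tensorTensorTensorComm k K C K C).toLinearMap) ?_ t
  refine TensorProduct.ext_fourfold' fun x c y d => ?_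
  simp only [LinearMap.comp_apply, LinearEquiv.coe_coe, tensorTensorTensorComm_tmul, map_tmul,
    LinearMap.mul'_apply, LinearMap.id_apply, tensorFunctional_tmul, LinearMap.sum_apply,
    hp.mul_right, sw2_apply_repr _ _ R, LinearMap.flip_apply, Finset.sum_mul]
  exact Finset.sum_congr rfl fun i _ => by ring

variable [Coalgebra k C]

theorem IsHopfPairing.tensorFunctional_mulFirst (hp : IsHopfPairing k p) {h : H} {ι : Type*}
    (R : Coalgebra.Repr k h ι) (g : H) (f : C →ₗ[k] k) (t : (K ⊗[k] C) ⊗[k] (K ⊗[k] C)) :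
    tensorFunctional (p h) (tensorFunctional (p g) f) (mulFirst k (TensorProduct.map (psiHC k)
      ((TensorProduct.assoc k K K C).toLinearMap ∘ₗ
        TensorProduct.map (Coalgebra.comul (R := k)) LinearMap.id) t)) =
    ∑ i ∈ R.index, tensorFunctional (tensorFunctional (p (R.left i)) Coalgebra.counit)
      (tensorFunctional (p (R.right i * g)) f) t := by
  rw [← LinearMap.sum_apply]
  refine LinearMap.congr_fun (f := tensorFunctional (p h) (tensorFunctional (p g) f) ∘ₗ
    mulFirst k ∘ₗ TensorProduct.map (psiHC k) ((TensorProduct.assoc k K K C).toLinearMap ∘ₗ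
      TensorProduct.map (Coalgebra.comul (R := k)) LinearMap.id)) ?_ t
  refine TensorProduct.ext_fourfold' fun x c y d => ?_
  let S := Coalgebra.Repr.arbitrary k y
  simp only [LinearMap.comp_apply, LinearEquiv.coe_coe, map_tmul, ← S.eq, sum_tmul, tmul_sum,
    map_sum, psiHC, mulFirst, assoc_tmul, assoc_symm_tmul, rid_tmul, LinearMap.mul'_apply,
    LinearMap.id_apply, tensorFunctional_tmul, LinearMap.sum_apply, smul_mul_assoc, map_smul,
    smul_eq_mul, hp.mul_right, hp.mul_left, sw2_apply_repr _ _ R, sw2_apply_repr _ _ S,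
    LinearMap.flip_apply, Finset.sum_mul, Finset.mul_sum]
  rw [Finset.sum_comm]
  exact Finset.sum_congr rfl fun i _ => Finset.sum_congr rfl fun j _ => by ring

theorem IsHopfPairing.tensorFunctional_mulFirst_comm (hp : IsHopfPairing k p) {h : H} {ι : Type*}
    (R : Coalgebra.Repr k h ι) (g : H) (f : C →ₗ[k] k) (t : (K ⊗[k] C) ⊗[k] (K ⊗[k] C)) :
    tensorFunctional (p h) (tensorFunctional (p g) f) (mulFirst k
      ((TensorProduct.map LinearMap.id (TensorProduct.comm k (K ⊗[k] C) K).toLinearMap)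
        ((TensorProduct.assoc k K (K ⊗[k] C) K) (TensorProduct.map
          ((TensorProduct.assoc k K K C).toLinearMap ∘ₗ
            TensorProduct.map (Coalgebra.comul (R := k)) LinearMap.id) (psiHC k) t)))) =
    ∑ i ∈ R.index, tensorFunctional (tensorFunctional (p (R.left i * g)) f)
      (tensorFunctional (p (R.right i)) Coalgebra.counit) t := by
  rw [← LinearMap.sum_apply]
  refine LinearMap.congr_fun (f := tensorFunctional (p h) (tensorFunctional (p g) f) ∘ₗ
    mulFirst k ∘ₗ
    TensorProduct.map LinearMap.id (TensorProduct.comm k (K ⊗[k] C) K).toLinearMap ∘ₗ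
    (TensorProduct.assoc k K (K ⊗[k] C) K).toLinearMap ∘ₗ TensorProduct.map
      ((TensorProduct.assoc k K K C).toLinearMap ∘ₗ
        TensorProduct.map (Coalgebra.comul (R := k)) LinearMap.id) (psiHC k)) ?_ t
  refine TensorProduct.ext_fourfold' fun x c y d => ?_
  let S := Coalgebra.Repr.arbitrary k x
  simp only [LinearMap.comp_apply, LinearEquiv.coe_coe, map_tmul, ← S.eq, sum_tmul,
    map_sum, psiHC, mulFirst, assoc_tmul, assoc_symm_tmul, comm_tmul, rid_tmul,
    LinearMap.mul'_apply, LinearMap.id_apply, tensorFunctional_tmul, LinearMap.sum_apply,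
    mul_smul_comm, map_smul, smul_eq_mul, hp.mul_right, hp.mul_left, sw2_apply_repr _ _ R,
    sw2_apply_repr _ _ S, LinearMap.flip_apply, Finset.sum_mul, Finset.mul_sum]
  rw [Finset.sum_comm]
  exact Finset.sum_congr rfl fun i _ => Finset.sum_congr rfl fun j _ => by ring

end

/-- Let `⟨-,-⟩ : H ⊗ K → k` be a dual pairing of Hopf algebras, `(-,-) : A ⊗ C → k` a
non-degenerate dual pairing between a unital algebra `A` and a coalgebra `C`, and let `C` be
a left partial `K`-comodule coalgebra with coaction `λ` satisfying also the symmetric axiom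
(PLHCC3'). If `· : H ⊗ A → A` is a linear map satisfying `(h·a, c) = ⟨h, c⁽⁻¹⁾⟩(a, c⁽⁰⁾)`
for all `h`, `a`, `c`, then `·` is a symmetric left partial action of `H` on `A`. -/
theorem partialComoduleCoalgebra_to_partialModuleAlgebra
    {k H K A C : Type*} [Field k] [Ring H] [HopfAlgebra k H] [Ring K] [HopfAlgebra k K]
    [Ring A] [Algebra k A] [AddCommGroup C] [Module k C] [Coalgebra k C]
    (p : H →ₗ[k] K →ₗ[k] k) (hp : IsHopfPairing k p)
    (q : A →ₗ[k] C →ₗ[k] k) (hq : IsAlgCoalgPairing k q)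
    (hnd₁ : ∀ a : A, (∀ c : C, q a c = 0) → a = 0)
    (hnd₂ : ∀ c : C, (∀ a : A, q a c = 0) → c = 0)
    (lam : C →ₗ[k] K ⊗[k] C) (hlam : IsPartialComoduleCoalgebra k lam)
    (hlam' : PLHCC3' k lam)
    (act : H →ₗ[k] A →ₗ[k] A)
    (hcompat : ∀ (h : H) (a : A) (c : C), q (act h a) c =
      (TensorProduct.lid k k) (TensorProduct.map (p h) (q a) (lam c))) :
    IsSymmPartialAction k act := by
  have hsep : ∀ a b : A, (∀ c, q a c = q b c) → a = b := fun a b hab =>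
    sub_eq_zero.mp (hnd₁ _ fun c => by simp [hab c])
  have hact : ∀ h a, q (act h a) = tensorFunctional (p h) (q a) ∘ₗ lam := fun h a =>
    LinearMap.ext (hcompat h a)
  have hmul : ∀ a b c, q (a * b) c = tensorFunctional (q a) (q b) (Coalgebra.comul c) :=
    hq.pair_mul
  have hone : q 1 = Coalgebra.counit := LinearMap.ext hq.pair_one
  refine ⟨fun a => hsep _ _ fun c => ?_, fun h a b => hsep _ _ fun c => ?_,
    fun h g a => hsep _ _ fun c => ?_, fun h g a => hsep _ _ fun c => ?_⟩
  · have hp1 : p 1 = Coalgebra.counit := LinearMap.ext hp.one_left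
    have hcounit : tensorFunctional Coalgebra.counit (q a) = q a ∘ₗ
        (TensorProduct.lid k C).toLinearMap ∘ₗ
          TensorProduct.map (Coalgebra.counit (R := k) (A := K)) LinearMap.id :=
      TensorProduct.ext' fun x c => by simp
    rw [hact, hp1, hcounit]
    exact congrArg (q a) (hlam.plhcc2 c)
  · have hab : q (a * b) = tensorFunctional (q a) (q b) ∘ₗ Coalgebra.comul :=
      LinearMap.ext (hmul a b)
    have key := hp.tensorFunctional_mul' (Coalgebra.Repr.arbitrary k h) (q a) (q b)
      (TensorProduct.map lam lam (Coalgebra.comul (R := k) c))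
    rw [← hlam.plhcc1, tensorFunctional_map, LinearMap.comp_id, ← hab] at key
    rw [hact, LinearMap.comp_apply, key, sw2_apply_repr _ _ (Coalgebra.Repr.arbitrary k h)]
    simp only [map_sum, LinearMap.sum_apply, hmul, LinearMap.flip_apply, hact,
      tensorFunctional_map]
  · have key := hp.tensorFunctional_mulFirst (Coalgebra.Repr.arbitrary k h) g (q a)
      (TensorProduct.map lam lam (Coalgebra.comul (R := k) c))
    rw [← hlam.plhcc3, tensorFunctional_map, LinearMap.comp_id, ← hact] at key
    rw [hact, LinearMap.comp_apply, key, sw2_apply_repr _ _ (Coalgebra.Repr.arbitrary k h)]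
    simp only [map_sum, LinearMap.sum_apply, hmul, LinearMap.flip_apply, hact, hone,
      LinearMap.comp_apply, LinearMap.mulRight_apply, tensorFunctional_map]
  · have key := hp.tensorFunctional_mulFirst_comm (Coalgebra.Repr.arbitrary k h) g (q a)
      (TensorProduct.map lam lam (Coalgebra.comul (R := k) c))
    rw [← hlam' c, tensorFunctional_map, LinearMap.comp_id, ← hact] at key
    rw [hact, LinearMap.comp_apply, key, sw2_apply_repr _ _ (Coalgebra.Repr.arbitrary k h)]
    simp only [map_sum, LinearMap.sum_apply, hmul, LinearMap.flip_apply, hact, hone,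
      LinearMap.comp_apply, LinearMap.mulRight_apply, tensorFunctional_map]
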